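/- Let m > 1 be an odd integer and let G be defined as below. Then, modulo [m]^3·Φ_m(q), the following q-congruence of rational functions holds: G(m,1) ≡ -(1+q)·q·[m]^3. -/

import Mathlib

open Finset Polynomial

/-- The variable `q`, viewed as a rational function over `ℚ`. -/
noncomputable def q : RatFunc ℚ := RatFunc.X

/-- The q-shifted factorial `(a; b)_n = (1-a)(1-ab)⋯(1-ab^{n-1})`. -/
noncomputable def qpoch (a b : RatFunc ℚ) (n : ℕ) : RatFunc ℚ :=
  ∏ i ∈ Finset.range n, (1 - a * b ^ i)

/-- The q-integer `[m] = (1-q^m)/(1-q)` (for an arbitrary integer `m`). -/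
noncomputable def qint (m : ℤ) : RatFunc ℚ := (1 - q ^ m) / (1 - q)

/-- The q-integer `[n] = 1 + q + ⋯ + q^{n-1}` as a polynomial. -/
noncomputable def qintPoly (n : ℕ) : Polynomial ℚ := ∑ i ∈ Finset.range n, Polynomial.X ^ i

/-- The central q-binomial coefficient `[2k choose k] = (q;q)_{2k}/(q;q)_k^2`. -/
noncomputable def qcb (k : ℕ) : RatFunc ℚ := qpoch q q (2 * k) / (qpoch q q k) ^ 2

/-- Two rational functions are congruent modulo a polynomial `P` iff `P` divides the
numerator of the reduced form of their difference. -/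
def ratCongr (A B : RatFunc ℚ) (P : Polynomial ℚ) : Prop := P ∣ (A - B).num

/-- The function `F(n,k)` of the q-WZ pair. -/
noncomputable def F (n : ℕ) (k : ℤ) : RatFunc ℚ :=
  qint (3 * n + 2 * k + 1) * qpoch q (q ^ 2) n * (qpoch (q ^ (2 * k + 1)) (q ^ 2) n) ^ 2 *
    q ^ (-((n : ℤ) * ((n : ℤ) + 1) / 2) - (2 * (n : ℤ) + 1) * k) /
    ((qpoch q q n) ^ 2 * qpoch (q ^ 2) (q ^ 2) n)

/-- The function `G(n,k)` of the q-WZ pair, with the convention `1/(q^2;q^2)_m = 0`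
for negative `m` (so `G(0,k) = 0`). -/
noncomputable def G (n : ℕ) (k : ℤ) : RatFunc ℚ :=
  if n = 0 then 0 else
    -((1 + q ^ ((n : ℤ) + 2 * k - 1)) * qpoch q (q ^ 2) n *
        (qpoch (q ^ (2 * k + 1)) (q ^ 2) (n - 1)) ^ 2 *
        q ^ (-((n : ℤ) * ((n : ℤ) - 1) / 2) - (2 * (n : ℤ) - 1) * k)) /
      ((1 - q) * (qpoch q q (n - 1)) ^ 2 * qpoch (q ^ 2) (q ^ 2) (n - 1))

/-- The polynomial `(X; X)_n`. -/
noncomputable def polyPoch (n : ℕ) : ℚ[X] := ∏ i ∈ Finset.range n, (1 - X ^ (i + 1))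

/-- The polynomial `(-X; X)_n`. -/
noncomputable def polyPochNeg (n : ℕ) : ℚ[X] := ∏ i ∈ Finset.range n, (1 + X ^ (i + 1))

/-- The polynomial `(X; X ^ 2)_n`. -/
noncomputable def polyPochOdd (n : ℕ) : ℚ[X] := ∏ i ∈ Finset.range n, (1 - X ^ (2 * i + 1))

theorem one_sub_X_pow_ne_zero (k : ℕ) : (1 - X ^ (k + 1) : ℚ[X]) ≠ 0 := by
  rw [← neg_ne_zero, neg_sub]
  exact X_pow_sub_C_ne_zero k.succ_pos 1

theorem polyPoch_ne_zero (n : ℕ) : polyPoch n ≠ 0 :=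
  Finset.prod_ne_zero_iff.mpr fun i _ => one_sub_X_pow_ne_zero i

theorem polyPoch_succ (n : ℕ) : polyPoch (n + 1) = polyPoch n * (1 - X ^ (n + 1)) :=
  Finset.prod_range_succ _ _

/-- The Gaussian binomial coefficients are polynomials. -/
theorem exists_mul_polyPoch_eq (a b : ℕ) :
    ∃ c : ℚ[X], c * (polyPoch a * polyPoch b) = polyPoch (a + b) := by
  induction a generalizing b with
  | zero => exact ⟨1, by simp [polyPoch]⟩
  | succ a iha =>
    induction b with
    | zero => exact ⟨1, by simp [polyPoch]⟩
    | succ b ihb =>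
      obtain ⟨c, hc⟩ := iha (b + 1)
      obtain ⟨d, hd⟩ := ihb
      refine ⟨c + X ^ (a + 1) * d, ?_⟩
      rw [show a + (b + 1) = a + 1 + b by ring] at hc
      rw [← add_assoc, polyPoch_succ (a + 1 + b)]
      have h : (1 - X ^ (a + 1 + b + 1) : ℚ[X]) =
          (1 - X ^ (a + 1)) + X ^ (a + 1) * (1 - X ^ (b + 1)) := by ring
      rw [h, mul_add, ← hc]
      nth_rewrite 2 [hc]
      rw [← hd, polyPoch_succ a, polyPoch_succ b]
      ring

theorem polyPoch_mul_polyPochNeg (n : ℕ) :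
    polyPoch n * polyPochNeg n = ∏ i ∈ Finset.range n, (1 - X ^ (2 * (i + 1))) := by
  rw [polyPoch, polyPochNeg, ← Finset.prod_mul_distrib]
  exact Finset.prod_congr rfl fun i _ => by ring

theorem polyPochOdd_succ_mul (n : ℕ) :
    polyPochOdd (n + 1) * (polyPoch n * polyPochNeg n) = polyPoch (2 * n + 1) := by
  rw [polyPoch_mul_polyPochNeg]
  induction n with
  | zero => simp [polyPochOdd, polyPoch]
  | succ n ih =>
    rw [show 2 * (n + 1) + 1 = 2 * n + 1 + 1 + 1 by ring, polyPoch_succ, polyPoch_succ, ← ih,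
      polyPochOdd, Finset.prod_range_succ, ← polyPochOdd, Finset.prod_range_succ]
    ring

theorem polyPoch_two_mul_add_one (n : ℕ) :
    polyPoch (2 * n + 1) =
      polyPoch n * (1 - X ^ (n + 1)) * ∏ i ∈ Finset.range n, (1 - X ^ (n + 1 + (i + 1))) := by
  rw [show 2 * n + 1 = n + 1 + n by ring, polyPoch, Finset.prod_range_add, ← polyPoch,
    polyPoch_succ]
  rfl

/-- A polynomial witness for the Gaussian binomial coefficient `[2n+1 choose n]`,
together with the factorisation of `(X; X ^ 2)_{n+1}` it induces. -/
theorem exists_polyPochOdd_mul_eq (n : ℕ) : ∃ c : ℚ[X],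
    polyPochOdd (n + 1) * polyPochNeg n = c * polyPoch n * (1 - X ^ (n + 1)) ∧
      c * polyPoch n = ∏ i ∈ Finset.range n, (1 - X ^ (n + 1 + (i + 1))) := by
  obtain ⟨c, hc⟩ := exists_mul_polyPoch_eq n (n + 1)
  rw [show n + (n + 1) = 2 * n + 1 by ring] at hc
  refine ⟨c, mul_left_cancel₀ (polyPoch_ne_zero n) ?_,
    mul_left_cancel₀ (polyPoch_ne_zero (n + 1)) ?_⟩
  · rw [polyPoch_succ, ← polyPochOdd_succ_mul] at hc
    linear_combination -hc
  · rw [polyPoch_two_mul_add_one, ← polyPoch_succ] at hc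
    linear_combination hc

theorem isCoprime_one_add_X_pow {m : ℕ} (hodd : Odd m) (i : ℕ) :
    IsCoprime (X ^ m - 1 : ℚ[X]) (1 + X ^ i) := by
  obtain ⟨u, hu⟩ : (X ^ m - 1 : ℚ[X]) ∣ (X ^ m) ^ i - 1 := by
    simpa using sub_dvd_pow_sub_pow (X ^ m : ℚ[X]) 1 i
  obtain ⟨v, hv⟩ : (X ^ i + 1 : ℚ[X]) ∣ (X ^ i) ^ m + 1 := by
    simpa using hodd.add_dvd_pow_add_pow (X ^ i : ℚ[X]) 1
  have h : (C (1 / 2) * 2 : ℚ[X]) = 1 := by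
    rw [← map_ofNat C 2, ← C_mul]
    norm_num
  refine ⟨-C (1 / 2) * u, C (1 / 2) * v, ?_⟩
  rw [pow_right_comm] at hu
  linear_combination h + C (1 / 2) * hu - C (1 / 2) * hv

theorem isCoprime_X_pow_sub_one_X {m : ℕ} (hm : m ≠ 0) : IsCoprime (X ^ m - 1 : ℚ[X]) X := by
  obtain ⟨n, rfl⟩ := Nat.exists_eq_add_one_of_ne_zero hm
  exact ⟨-1, X ^ n, by ring⟩

theorem isCoprime_polyPochNeg {m : ℕ} (hodd : Odd m) (n : ℕ) :
    IsCoprime (X ^ m - 1 : ℚ[X]) (polyPochNeg n) :=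
  IsCoprime.prod_right fun i _ => isCoprime_one_add_X_pow hodd (i + 1)

theorem qintPoly_mul (m : ℕ) : qintPoly m * (X - 1) = X ^ m - 1 := geom_sum_mul _ _

theorem isCoprime_modulus {m : ℕ} {d : ℚ[X]} (h : IsCoprime (X ^ m - 1 : ℚ[X]) d) :
    IsCoprime (qintPoly m ^ 3 * cyclotomic m ℚ) d :=
  ((h.of_isCoprime_of_dvd_left (Dvd.intro _ (qintPoly_mul m))).pow_left).mul_left
    (h.of_isCoprime_of_dvd_left (cyclotomic.dvd_X_pow_sub_one m ℚ))

theorem ratCongr_of_sub_eq_div {A B : RatFunc ℚ} {P N D : ℚ[X]} (hD : D ≠ 0)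
    (hPD : IsCoprime P D) (hPN : P ∣ N)
    (h : A - B = algebraMap ℚ[X] (RatFunc ℚ) N / algebraMap ℚ[X] (RatFunc ℚ) D) :
    ratCongr A B P := by
  rw [← RatFunc.num_mul_eq_mul_denom_iff hD] at h
  exact hPD.dvd_of_dvd_mul_right (h ▸ hPN.mul_right _)

theorem IsPrimitiveRoot.aeval_polyPoch {n : ℕ} {ζ : ℂ} (hζ : IsPrimitiveRoot ζ (n + 1)) :
    aeval ζ (polyPoch n) = n + 1 := by
  simpa [polyPoch, map_prod] using hζ.prod_one_sub_pow_eq_order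

theorem IsPrimitiveRoot.aeval_polyPochNeg {n : ℕ} {ζ : ℂ} (hζ : IsPrimitiveRoot ζ (n + 1))
    (hodd : Odd (n + 1)) : aeval ζ (polyPochNeg n) = 1 := by
  have h := congrArg (aeval ζ) (polyPoch_mul_polyPochNeg n)
  have h2 := (hζ.pow_of_coprime 2 hodd.coprime_two_left).prod_one_sub_pow_eq_order
  simp only [← pow_mul] at h2
  simp only [map_mul, map_prod, map_sub, map_one, map_pow, aeval_X, hζ.aeval_polyPoch, h2] at h
  exact mul_left_cancel₀ (Nat.cast_add_one_ne_zero n) (h.trans (mul_one _).symm)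

/-- The polynomial numerator left after dividing `G(n+1,1) + (1+q) q [n+1]^3` by `[n+1]^3`
vanishes at the primitive roots of unity of order `n+1`. -/
theorem cyclotomic_dvd_numerator {n e : ℕ} (hodd : Odd (n + 1)) (he : n + 1 ∣ e + 1) {c : ℚ[X]}
    (hc : c * polyPoch n = ∏ i ∈ Finset.range n, (1 - X ^ (n + 1 + (i + 1)))) :
    cyclotomic (n + 1) ℚ ∣
      (1 + X) * X ^ (e + 1) * polyPochNeg n ^ 4 - (1 + X ^ (n + 2)) * c ^ 3 := by
  have hζ := Complex.isPrimitiveRoot_exp (n + 1) n.succ_ne_zero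
  set ζ := Complex.exp (2 * Real.pi * Complex.I / (n + 1 : ℕ))
  have hc1 : aeval ζ c = 1 := by
    have h := congrArg (aeval ζ) hc
    have h2 := hζ.prod_one_sub_pow_eq_order
    simp only [map_mul, map_prod, map_sub, map_one, map_pow, aeval_X, hζ.aeval_polyPoch,
      pow_add ζ (n + 1), hζ.pow_eq_one, one_mul, h2] at h
    exact mul_right_cancel₀ (Nat.cast_add_one_ne_zero n) (h.trans (one_mul _).symm)
  rw [cyclotomic_eq_minpoly_rat hζ n.succ_pos]
  apply minpoly.dvd
  simp only [map_sub, map_mul, map_add, map_one, map_pow, aeval_X, hc1,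
    hζ.aeval_polyPochNeg hodd, (hζ.pow_eq_one_iff_dvd _).mpr he, pow_succ ζ (n + 1),
    hζ.pow_eq_one]
  ring

theorem algebraMap_X_eq_q : algebraMap ℚ[X] (RatFunc ℚ) X = q := RatFunc.algebraMap_X

theorem algebraMap_polyPoch (n : ℕ) :
    algebraMap ℚ[X] (RatFunc ℚ) (polyPoch n) = qpoch q q n := by
  simp [polyPoch, qpoch, q, map_prod, pow_succ']

theorem algebraMap_polyPoch_mul_polyPochNeg (n : ℕ) :
    algebraMap ℚ[X] (RatFunc ℚ) (polyPoch n * polyPochNeg n) = qpoch (q ^ 2) (q ^ 2) n := by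
  rw [polyPoch_mul_polyPochNeg]
  simp [qpoch, q, map_prod, ← pow_mul, ← pow_add, mul_add, add_comm]

theorem algebraMap_polyPochOdd (n : ℕ) :
    algebraMap ℚ[X] (RatFunc ℚ) (polyPochOdd n) = qpoch q (q ^ 2) n := by
  simp [polyPochOdd, qpoch, q, map_prod, pow_mul, pow_succ' _ (2 * _)]

theorem qpoch_sq_succ (n : ℕ) :
    qpoch q (q ^ 2) (n + 1) = (1 - q) * qpoch (q ^ 3) (q ^ 2) n := by
  rw [qpoch, Finset.prod_range_succ', mul_comm, qpoch]
  congr 1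
  · simp
  · exact Finset.prod_congr rfl fun i _ => by ring

theorem one_sub_q_ne_zero : (1 - q : RatFunc ℚ) ≠ 0 := by
  have h := RatFunc.algebraMap_ne_zero (one_sub_X_pow_ne_zero 0)
  simpa [q] using h

theorem algebraMap_qintPoly (n : ℕ) :
    algebraMap ℚ[X] (RatFunc ℚ) (qintPoly n) = qint n := by
  rw [qint, eq_div_iff one_sub_q_ne_zero]
  have h := congrArg (algebraMap ℚ[X] (RatFunc ℚ)) (qintPoly_mul n)
  simp only [map_mul, map_sub, map_pow, map_one, algebraMap_X_eq_q] at h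
  rw [zpow_natCast]
  linear_combination -h

/-- `G(n+1,1)` in terms of the Gaussian binomial coefficient `[2n+1 choose n]`. -/
theorem G_succ_one {n e : ℕ} (he : 2 * e = (n + 1) * n + 2 * (2 * n + 1)) {c : ℚ[X]}
    (hc : polyPochOdd (n + 1) * polyPochNeg n = c * polyPoch n * (1 - X ^ (n + 1))) :
    G (n + 1) 1 = -((1 + q ^ (n + 2)) * algebraMap ℚ[X] (RatFunc ℚ) c ^ 3 *
      qint (n + 1 : ℕ) ^ 3) / (q ^ e * algebraMap ℚ[X] (RatFunc ℚ) (polyPochNeg n) ^ 4) := by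
  have hexp : (-(((n + 1 : ℕ) : ℤ) * (((n + 1 : ℕ) : ℤ) - 1) / 2) -
      (2 * ((n + 1 : ℕ) : ℤ) - 1) * 1) = -(e : ℤ) := by
    have : ((n + 1 : ℕ) : ℤ) * (((n + 1 : ℕ) : ℤ) - 1) = 2 * (e - (2 * n + 1)) := by
      zify at he
      push_cast
      linear_combination -he
    rw [this, Int.mul_ediv_cancel_left _ two_ne_zero]
    push_cast
    ring
  have hA := RatFunc.algebraMap_ne_zero (polyPoch_ne_zero n)
  have hB : algebraMap ℚ[X] (RatFunc ℚ) (polyPochNeg n) ≠ 0 := by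
    refine RatFunc.algebraMap_ne_zero (right_ne_zero_of_mul (a := polyPoch n) ?_)
    rw [polyPoch_mul_polyPochNeg]
    exact Finset.prod_ne_zero_iff.mpr fun i _ => one_sub_X_pow_ne_zero (2 * i + 1)
  have hodd := congrArg (algebraMap ℚ[X] (RatFunc ℚ)) hc
  simp only [map_mul, map_sub, map_pow, map_one, algebraMap_X_eq_q, algebraMap_polyPochOdd]
    at hodd
  have h1 : (((n + 1 : ℕ) : ℤ) + 2 * 1 - 1) = ((n + 2 : ℕ) : ℤ) := by push_cast; ring
  have h3 : (2 * 1 + 1 : ℤ) = (3 : ℕ) := by norm_num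
  rw [G, if_neg n.succ_ne_zero, hexp, h1, h3, zpow_natCast, zpow_natCast, zpow_neg, zpow_natCast,
    Nat.add_sub_cancel, ← algebraMap_polyPoch_mul_polyPochNeg, ← algebraMap_polyPoch,
    map_mul, qint, zpow_natCast]
  have hO := qpoch_sq_succ n
  rw [hO] at hodd ⊢
  have hs := one_sub_q_ne_zero
  generalize qpoch (q ^ 3) (q ^ 2) n = O at *
  generalize algebraMap ℚ[X] (RatFunc ℚ) (polyPoch n) = A at *
  generalize algebraMap ℚ[X] (RatFunc ℚ) (polyPochNeg n) = B at *
  generalize algebraMap ℚ[X] (RatFunc ℚ) c = c at *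
  have hO' : O = c * A * (1 - q ^ (n + 1)) / ((1 - q) * B) := by
    rw [eq_div_iff (mul_ne_zero hs hB)]
    linear_combination hodd
  rw [hO']
  field_simp

theorem stmt_14 (m : ℕ) (hm : 1 < m) (hodd : Odd m) :
    ratCongr (G m 1) (-(1 + q) * q * (qint m) ^ 3)
      ((qintPoly m) ^ 3 * Polynomial.cyclotomic m ℚ) := by
  obtain ⟨n, rfl⟩ := Nat.exists_eq_add_one_of_ne_zero (zero_lt_one.trans hm).ne'
  obtain ⟨k, hk⟩ : ∃ k, n = 2 * k := by
    obtain ⟨k, hk⟩ := hodd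
    exact ⟨k, Nat.succ_injective hk⟩
  obtain ⟨e, he⟩ : ∃ e, e = (n + 1) * k + (2 * n + 1) := ⟨_, rfl⟩
  have he2 : 2 * e = (n + 1) * n + 2 * (2 * n + 1) := by rw [he, hk]; ring
  have hdvd : n + 1 ∣ e + 1 := ⟨k + 2, by rw [he]; ring⟩
  obtain ⟨c, hc, hc'⟩ := exists_polyPochOdd_mul_eq n
  have hcop : IsCoprime (X ^ (n + 1) - 1 : ℚ[X]) (X ^ e * polyPochNeg n ^ 4) :=
    (isCoprime_X_pow_sub_one_X n.succ_ne_zero).pow_right.mul_right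
      (isCoprime_polyPochNeg hodd n).pow_right
  have hD : (X ^ e * polyPochNeg n ^ 4 : ℚ[X]) ≠ 0 := by
    intro h0
    rw [h0, isCoprime_zero_right] at hcop
    exact not_isUnit_X_pow_sub_one ℚ (n + 1) hcop
  refine ratCongr_of_sub_eq_div hD (isCoprime_modulus hcop)
    (mul_dvd_mul_left _ (cyclotomic_dvd_numerator hodd hdvd hc')) ?_
  have hD' := RatFunc.algebraMap_ne_zero hD
  rw [G_succ_one he2 hc, eq_div_iff hD', sub_mul]
  simp only [map_mul, map_sub, map_add, map_pow, map_one, algebraMap_X_eq_q,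
    algebraMap_qintPoly] at hD' ⊢
  rw [div_mul_cancel₀ _ hD']
  ring
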